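/- Let M > 0, let h satisfy 0 < h < √(2/M), let x₀ ∈ ℝ, and let C₁ ≠ 0, C₂, C₃ be real constants such that cos(√(M/2)·(x₀ + mh) + C₂) ≠ 0 for all m ∈ ℤ. Define the sequence u(m) = C₁·tan(√(M/2)·(x₀ + mh) + C₂) + C₃, i.e., the exact solution of the Schwarzian ODE with parameter M sampled on the uniform mesh x_m = x₀ + mh. Then u satisfies the four-point equation (u(m+3) − u(m+1))·(u(m+2) − u(m)) = K̄·(u(m+3) − u(m+2))·(u(m+1) − u(m)) for all m ∈ ℤ, where K̄ = 4·cos²(√(M/2)·h) = 4·(1 − M_mod·h²/2) with M_mod = (2/h²)·sin²(√(M/2)·h). -/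

import Mathlib

theorem tan_sub_tan_aux (a b d : ℝ) (ha : Real.cos a ≠ 0) (hb : Real.cos b ≠ 0)
    (hd : d = a - b) :
    Real.tan a - Real.tan b = Real.sin d / (Real.cos a * Real.cos b) := by
  rw [hd, Real.tan_eq_sin_div_cos, Real.tan_eq_sin_div_cos, Real.sin_sub]
  field_simp

/-- the exact solution `u(x) = C₁·tan(√(M/2)x + C₂) + C₃` of the
Schwarzian ODE (`M > 0`) sampled on the uniform mesh `x_m = x₀ + mh`,
`0 < h < √(2/M)`, satisfies the four-point discrete Schwarzian equation with the
modified parameter `K̄ = 4·cos²(√(M/2)·h) = 4·(1 − M_mod·h²/2)`,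
`M_mod = (2/h²)·sin²(√(M/2)·h)`. -/
theorem discrete_schwarzian_exactness (M h x₀ C₁ C₂ C₃ : ℝ)
    (hM : 0 < M) (hh0 : 0 < h) (hh1 : h < Real.sqrt (2 / M)) (hC₁ : C₁ ≠ 0)
    (hcos : ∀ m : ℤ,
      Real.cos (Real.sqrt (M / 2) * (x₀ + (m : ℝ) * h) + C₂) ≠ 0) :
    let u : ℤ → ℝ := fun m => C₁ * Real.tan (Real.sqrt (M / 2) * (x₀ + (m : ℝ) * h) + C₂) + C₃
    let Kbar : ℝ := 4 * (Real.cos (Real.sqrt (M / 2) * h)) ^ 2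
    let Mmod : ℝ := (2 / h ^ 2) * (Real.sin (Real.sqrt (M / 2) * h)) ^ 2
    (∀ m : ℤ, (u (m + 3) - u (m + 1)) * (u (m + 2) - u m)
        = Kbar * (u (m + 3) - u (m + 2)) * (u (m + 1) - u m)) ∧
    Kbar = 4 * (1 - Mmod * h ^ 2 / 2) := by
  intro u Kbar Mmod
  have key : ∀ a b : ℤ, u a - u b = C₁ * (Real.sin (Real.sqrt (M / 2) * h * ((a : ℝ) - b)) /
      (Real.cos (Real.sqrt (M / 2) * (x₀ + (a : ℝ) * h) + C₂) *
        Real.cos (Real.sqrt (M / 2) * (x₀ + (b : ℝ) * h) + C₂))) := by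
    intro a b
    rw [← tan_sub_tan_aux _ _ _ (hcos a) (hcos b) (by ring)]
    simp only [u]
    ring
  refine ⟨?_, ?_⟩
  · intro m
    rw [key, key, key, key]
    have e1 : Real.sqrt (M / 2) * h * (((m + 3 : ℤ) : ℝ) - ((m + 1 : ℤ) : ℝ))
        = 2 * (Real.sqrt (M / 2) * h) := by push_cast; ring
    have e2 : Real.sqrt (M / 2) * h * (((m + 2 : ℤ) : ℝ) - (m : ℝ))
        = 2 * (Real.sqrt (M / 2) * h) := by push_cast; ring
    have e3 : Real.sqrt (M / 2) * h * (((m + 3 : ℤ) : ℝ) - ((m + 2 : ℤ) : ℝ))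
        = Real.sqrt (M / 2) * h := by push_cast; ring
    have e4 : Real.sqrt (M / 2) * h * (((m + 1 : ℤ) : ℝ) - (m : ℝ))
        = Real.sqrt (M / 2) * h := by push_cast; ring
    rw [e1, e2, e3, e4, Real.sin_two_mul]
    have h0 := hcos m
    have h1 := hcos (m + 1)
    have h2 := hcos (m + 2)
    have h3 := hcos (m + 3)
    simp only [Kbar]
    generalize Real.cos (Real.sqrt (M / 2) * (x₀ + (m : ℝ) * h) + C₂) = c0 at *
    generalize Real.cos (Real.sqrt (M / 2) * (x₀ + ((m + 1 : ℤ) : ℝ) * h) + C₂) = c1 at *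
    generalize Real.cos (Real.sqrt (M / 2) * (x₀ + ((m + 2 : ℤ) : ℝ) * h) + C₂) = c2 at *
    generalize Real.cos (Real.sqrt (M / 2) * (x₀ + ((m + 3 : ℤ) : ℝ) * h) + C₂) = c3 at *
    field_simp
    try ring
  · simp only [Kbar, Mmod]
    have hne : h ≠ 0 := hh0.ne'
    rw [Real.cos_sq']
    field_simp
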